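/- Let Q* : S × A → ℝ satisfy T Q* = Q*, let n = (card S)·(card A), let Φ be a feature matrix, and define f(θ) = (1/2)·‖T Q_θ − Q_θ‖₂². Suppose θ₁* minimizes θ ↦ ‖Q_θ − Q*‖₂ over all θ : Fin m → ℝ, and θ₂* is a global minimizer of f. Then 0 ≤ f(θ₁*) − f(θ₂*) ≤ ((1+γ)²·n/2 − (1−γ)²/(2n))·‖Q_{θ₁*} − Q*‖₂². -/

import Mathlib

noncomputable def l2Norm {S A : Type*} [Fintype S] [Fintype A] (Q : S × A → ℝ) : ℝ :=
  Real.sqrt (∑ p : S × A, (Q p) ^ 2)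

/-- The control Bellman operator `T`. -/
noncomputable def bellT {S A : Type*} [Fintype S] [Fintype A] [Nonempty A]
    (P : S → A → S → ℝ) (R : S → A → ℝ) (γ : ℝ) (Q : S × A → ℝ) : S × A → ℝ :=
  fun p => R p.1 p.2 + γ * ∑ s' : S, P p.1 p.2 s' *
    (Finset.univ.sup' Finset.univ_nonempty fun a' : A => Q (s', a'))

theorem l2Norm_sq {S A : Type*} [Fintype S] [Fintype A] (Q : S × A → ℝ) :
    l2Norm Q ^ 2 = ∑ p : S × A, Q p ^ 2 :=
  Real.sq_sqrt (Finset.sum_nonneg fun _ _ => sq_nonneg _)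

/-- The Bellman operator is a `γ`-contraction for the sup norm. -/
theorem abs_bellT_sub_bellT_le {S A : Type*} [Fintype S] [Fintype A] [Nonempty A]
    (P : S → A → S → ℝ) (R : S → A → ℝ) {γ : ℝ}
    (hP0 : ∀ s a s', 0 ≤ P s a s') (hP1 : ∀ s a, ∑ s' : S, P s a s' = 1) (hγ0 : 0 ≤ γ)
    {Q Q' : S × A → ℝ} {M : ℝ} (hM : ∀ p, |Q p - Q' p| ≤ M) (p : S × A) :
    |bellT P R γ Q p - bellT P R γ Q' p| ≤ γ * M := by
  have key : ∀ U V : S × A → ℝ, (∀ p, U p ≤ V p + M) →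
      bellT P R γ U p ≤ bellT P R γ V p + γ * M := by
    intro U V hUV
    have hsup : ∀ s' : S, (Finset.univ.sup' Finset.univ_nonempty fun a' : A => U (s', a')) ≤
        (Finset.univ.sup' Finset.univ_nonempty fun a' : A => V (s', a')) + M := by
      intro s'
      refine Finset.sup'_le _ _ fun a _ => (hUV (s', a)).trans ?_
      gcongr
      exact Finset.le_sup' (fun a' : A => V (s', a')) (Finset.mem_univ a)
    have hsum := Finset.sum_le_sum fun s' (_ : s' ∈ Finset.univ) =>
      mul_le_mul_of_nonneg_left (hsup s') (hP0 p.1 p.2 s')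
    simp only [mul_add, Finset.sum_add_distrib, ← Finset.sum_mul, hP1, one_mul] at hsum
    have := mul_le_mul_of_nonneg_left hsum hγ0
    simp only [bellT]
    linarith
  have h₁ := key Q Q' fun q => by linarith [(abs_le.mp (hM q)).2]
  have h₂ := key Q' Q fun q => by linarith [(abs_le.mp (hM q)).1]
  exact abs_le.mpr ⟨by linarith, by linarith⟩

/-- Two-sided comparison of the Bellman residual of `Q` with its distance to a fixed point. -/
theorem bellman_residual_bounds {S A : Type*} [Fintype S] [Fintype A] [Nonempty S] [Nonempty A]
    (P : S → A → S → ℝ) (R : S → A → ℝ) {γ : ℝ}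
    (hP0 : ∀ s a s', 0 ≤ P s a s') (hP1 : ∀ s a, ∑ s' : S, P s a s' = 1)
    (hγ0 : 0 ≤ γ) (hγ1 : γ < 1) {Qstar : S × A → ℝ} (hfix : bellT P R γ Qstar = Qstar)
    (Q : S × A → ℝ) :
    l2Norm (fun p => bellT P R γ Q p - Q p) ^ 2 ≤
        (1 + γ) ^ 2 * ((Fintype.card S * Fintype.card A : ℕ) : ℝ) *
          l2Norm (fun p => Q p - Qstar p) ^ 2 ∧
      (1 - γ) ^ 2 * l2Norm (fun p => Q p - Qstar p) ^ 2 ≤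
        ((Fintype.card S * Fintype.card A : ℕ) : ℝ) *
          l2Norm (fun p => bellT P R γ Q p - Q p) ^ 2 := by
  rw [← Fintype.card_prod, l2Norm_sq, l2Norm_sq]
  obtain ⟨q, hq⟩ := Finite.exists_max fun p : S × A => |Q p - Qstar p|
  have hT := abs_bellT_sub_bellT_le P R hP0 hP1 hγ0 hq
  rw [hfix] at hT
  have hM : 0 ≤ |Q q - Qstar q| := abs_nonneg _
  have hMsq : |Q q - Qstar q| ^ 2 ≤ ∑ p, (Q p - Qstar p) ^ 2 := by
    rw [sq_abs]
    exact Finset.single_le_sum (f := fun p => (Q p - Qstar p) ^ 2)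
      (fun _ _ => sq_nonneg _) (Finset.mem_univ q)
  constructor
  · have hpt : ∀ p ∈ (Finset.univ : Finset (S × A)),
        (bellT P R γ Q p - Q p) ^ 2 ≤ ((1 + γ) * |Q q - Qstar q|) ^ 2 := by
      intro p _
      have h₁ := abs_le.mp (hT p)
      have h₂ := abs_le.mp (hq p)
      exact sq_le_sq' (by linarith) (by linarith)
    have h := Finset.sum_le_card_nsmul _ _ _ hpt
    rw [nsmul_eq_mul, Finset.card_univ] at h
    refine h.trans ?_
    rw [mul_pow, ← mul_assoc, mul_comm (Fintype.card (S × A) : ℝ)]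
    gcongr
  · have hpt : ∀ p ∈ (Finset.univ : Finset (S × A)),
        (Q p - Qstar p) ^ 2 ≤ |Q q - Qstar q| ^ 2 :=
      fun p _ => sq_le_sq.mpr (by rw [abs_abs]; exact hq p)
    have h := Finset.sum_le_card_nsmul _ _ _ hpt
    rw [nsmul_eq_mul, Finset.card_univ] at h
    have hlow : (1 - γ) * |Q q - Qstar q| ≤ |bellT P R γ Q q - Q q| := by
      have h₁ := abs_sub_le (Q q) (bellT P R γ Q q) (Qstar q)
      rw [abs_sub_comm (Q q) (bellT P R γ Q q)] at h₁
      linarith [hT q]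
    have hsq : ((1 - γ) * |Q q - Qstar q|) ^ 2 ≤ ∑ p, (bellT P R γ Q p - Q p) ^ 2 := by
      refine (pow_le_pow_left₀ (mul_nonneg (by linarith) hM) hlow 2).trans ?_
      rw [sq_abs]
      exact Finset.single_le_sum (f := fun p => (bellT P R γ Q p - Q p) ^ 2)
        (fun _ _ => sq_nonneg _) (Finset.mem_univ q)
    calc (1 - γ) ^ 2 * ∑ p, (Q p - Qstar p) ^ 2
        ≤ (1 - γ) ^ 2 * ((Fintype.card (S × A) : ℝ) * |Q q - Qstar q| ^ 2) := by gcongr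
      _ = (Fintype.card (S × A) : ℝ) * ((1 - γ) * |Q q - Qstar q|) ^ 2 := by ring
      _ ≤ _ := by gcongr

theorem stmt13 {S A : Type*} [Fintype S] [Fintype A] [Nonempty S] [Nonempty A] {m : ℕ}
    (P : S → A → S → ℝ) (R : S → A → ℝ) (γ : ℝ)
    (hP0 : ∀ s a s', 0 ≤ P s a s') (hP1 : ∀ s a, ∑ s' : S, P s a s' = 1)
    (hγ0 : 0 ≤ γ) (hγ1 : γ < 1)
    (Qstar : S × A → ℝ) (hfix : bellT P R γ Qstar = Qstar)
    (Φ : Matrix (S × A) (Fin m) ℝ) (θ₁ θ₂ : Fin m → ℝ)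
    (hθ₁ : ∀ θ : Fin m → ℝ,
      l2Norm (fun p => Φ.mulVec θ₁ p - Qstar p) ≤ l2Norm (fun p => Φ.mulVec θ p - Qstar p))
    (hθ₂ : ∀ θ : Fin m → ℝ,
      (1 / 2) * (l2Norm (fun p => bellT P R γ (Φ.mulVec θ₂) p - Φ.mulVec θ₂ p)) ^ 2
        ≤ (1 / 2) * (l2Norm (fun p => bellT P R γ (Φ.mulVec θ) p - Φ.mulVec θ p)) ^ 2) :
    0 ≤ (1 / 2) * (l2Norm (fun p => bellT P R γ (Φ.mulVec θ₁) p - Φ.mulVec θ₁ p)) ^ 2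
        - (1 / 2) * (l2Norm (fun p => bellT P R γ (Φ.mulVec θ₂) p - Φ.mulVec θ₂ p)) ^ 2
    ∧ (1 / 2) * (l2Norm (fun p => bellT P R γ (Φ.mulVec θ₁) p - Φ.mulVec θ₁ p)) ^ 2
        - (1 / 2) * (l2Norm (fun p => bellT P R γ (Φ.mulVec θ₂) p - Φ.mulVec θ₂ p)) ^ 2
      ≤ ((1 + γ) ^ 2 * ((Fintype.card S * Fintype.card A : ℕ) : ℝ) / 2
          - (1 - γ) ^ 2 / (2 * ((Fintype.card S * Fintype.card A : ℕ) : ℝ))) *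
        (l2Norm (fun p => Φ.mulVec θ₁ p - Qstar p)) ^ 2 := by
  refine ⟨sub_nonneg.mpr (hθ₂ θ₁), ?_⟩
  have hup := (bellman_residual_bounds P R hP0 hP1 hγ0 hγ1 hfix (Φ.mulVec θ₁)).1
  have hlow := (bellman_residual_bounds P R hP0 hP1 hγ0 hγ1 hfix (Φ.mulVec θ₂)).2
  have hn : (0 : ℝ) < ((Fintype.card S * Fintype.card A : ℕ) : ℝ) :=
    Nat.cast_pos.mpr (Nat.mul_pos Fintype.card_pos Fintype.card_pos)
  have hmin : l2Norm (fun p => Φ.mulVec θ₁ p - Qstar p) ^ 2 ≤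
      l2Norm (fun p => Φ.mulVec θ₂ p - Qstar p) ^ 2 :=
    pow_le_pow_left₀ (Real.sqrt_nonneg _) (hθ₁ θ₂) 2
  have hlow' := (mul_le_mul_of_nonneg_left hmin (sq_nonneg (1 - γ))).trans hlow
  rw [← div_le_iff₀' hn] at hlow'
  generalize ((Fintype.card S * Fintype.card A : ℕ) : ℝ) = n at *
  generalize l2Norm (fun p => Φ.mulVec θ₁ p - Qstar p) ^ 2 = e at *
  have hsplit : ((1 + γ) ^ 2 * n / 2 - (1 - γ) ^ 2 / (2 * n)) * e =
      1 / 2 * ((1 + γ) ^ 2 * n * e) - 1 / 2 * ((1 - γ) ^ 2 * e / n) := by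
    field_simp
  rw [hsplit]
  linarith
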